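/- arXiv:math/0601247 — 2 statements merged into one kernel-verified Lean document; each statement's English description precedes it below -/
import Mathlib

section
/- For every circle L ∈ ⟨p,K⟩, the set L ∖ {p} is a straight line of SA(p,K): for all distinct x, y ∈ L ∖ {p}, one has x ⊔ y = L ∖ {p}. -/
/-- A Laguerre plane: points, circles, and a parallelity relation. -/
structure LaguerrePlane (P : Type*) where
  Circles : Set (Set P)
  Par : P → P → Prop
  par_equiv : Equivalence Par
  joinCircle : ∀ a b c : P, ¬ Par a b → ¬ Par b c → ¬ Par a c →
    ∃! C, C ∈ Circles ∧ a ∈ C ∧ b ∈ C ∧ c ∈ C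
  touching : ∀ K ∈ Circles, ∀ p ∈ K, ∀ q, q ∉ K → ¬ Par p q →
    ∃! C, C ∈ Circles ∧ q ∈ C ∧ K ∩ C = {p}
  parPoint : ∀ (x : P), ∀ K ∈ Circles, ∃! q, Par x q ∧ q ∈ K
  nontriv : ∃ C ∈ Circles,
    (∃ a b c : P, a ∈ C ∧ b ∈ C ∧ c ∈ C ∧ a ≠ b ∧ b ≠ c ∧ a ≠ c) ∧ C ≠ Set.univ

namespace LaguerrePlane

variable {P : Type*}

/-- The generator (parallel class) of a point. -/
def gen (L : LaguerrePlane P) (p : P) : Set P := {q | L.Par p q}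

/-- The pencil ⟨p,K⟩: the circle K together with all circles tangent to K at p. -/
def pencil (L : LaguerrePlane P) (p : P) (K : Set P) : Set (Set P) :=
  insert K {M | M ∈ L.Circles ∧ M ∩ K = {p}}

/-- An automorphism of a Laguerre plane: a bijection of the points mapping
circles onto circles and preserving parallelity. -/
def IsAut (L : LaguerrePlane P) (σ : Equiv.Perm P) : Prop :=
  (∀ C, C ∈ L.Circles ↔ ⇑σ '' C ∈ L.Circles) ∧
  (∀ x y, L.Par x y ↔ L.Par (σ x) (σ y))

/-- The line x ⊔ y of the residual plane SA(p,K):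
{x} together with the orbit of y under the stabilizer of x in Δ. -/
def line (Δ : Subgroup (Equiv.Perm P)) (x y : P) : Set P :=
  {x} ∪ {z | ∃ σ ∈ Δ, σ x = x ∧ σ y = z}

/-- Parallelity of lines of the residual plane SA(p,K). -/
def LinePar (Δ : Subgroup (Equiv.Perm P)) (A B : Set P) : Prop :=
  ∃ σ ∈ Δ, ⇑σ '' A = B

end LaguerrePlane

open LaguerrePlane

namespace LaguerrePlane

variable {P : Type*} (L : LaguerrePlane P) {p : P} {K : Set P}

theorem mem_circles_of_mem_pencil (hK : K ∈ L.Circles) {C : Set P}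
    (hC : C ∈ L.pencil p K) : C ∈ L.Circles := by
  rcases hC with rfl | hC
  · exact hK
  · exact hC.1

theorem mem_of_mem_pencil (hpK : p ∈ K) {C : Set P} (hC : C ∈ L.pencil p K) : p ∈ C := by
  rcases hC with rfl | hC
  · exact hpK
  · exact (hC.2.symm ▸ Set.mem_singleton p : p ∈ C ∩ K).1

/-- Distinct points of a circle are not parallel. -/
theorem eq_of_par_of_mem {C : Set P} (hC : C ∈ L.Circles) {x y : P} (hx : x ∈ C) (hy : y ∈ C)
    (h : L.Par x y) : y = x :=
  (L.parPoint x C hC).unique ⟨h, hy⟩ ⟨L.par_equiv.refl x, hx⟩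

/-- Two circles of a pencil that share a point other than the carrier coincide. -/
theorem pencil_eq_of_common_point (hK : K ∈ L.Circles) (hpK : p ∈ K) {C D : Set P}
    (hC : C ∈ L.pencil p K) (hD : D ∈ L.pencil p K) {x : P} (hxC : x ∈ C) (hxD : x ∈ D)
    (hx : x ≠ p) : C = D := by
  have notMem {M : Set P} (hM : M ∩ K = {p}) (hxM : x ∈ M) : x ∉ K := fun h =>
    hx (Set.mem_singleton_iff.1 (hM.subset ⟨hxM, h⟩))
  have hpx : ¬ L.Par p x := fun h => hx
    (L.eq_of_par_of_mem (L.mem_circles_of_mem_pencil hK hC) (L.mem_of_mem_pencil hpK hC) hxC h)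
  rcases hC with rfl | hC
  · rcases hD with rfl | hD
    · rfl
    · exact absurd hxC (notMem hD.2 hxD)
  · rcases hD with rfl | hD
    · exact absurd hxD (notMem hC.2 hxC)
    · exact (L.touching K hK p hpK x (notMem hC.2 hxC) hpx).unique
        ⟨hC.1, hxC, Set.inter_comm K C ▸ hC.2⟩ ⟨hD.1, hxD, Set.inter_comm K D ▸ hD.2⟩

end LaguerrePlane

/-- for every circle C ∈ ⟨p,K⟩ the set C ∖ {p} is a straight line
of SA(p,K): for all distinct x, y ∈ C ∖ {p}, x ⊔ y = C ∖ {p}. -/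
theorem pencil_circles_are_straight_lines
    {P : Type*} (L : LaguerrePlane P) (p : P) (K : Set P)
    (Δ : Subgroup (Equiv.Perm P))
    (hK : K ∈ L.Circles) (hpK : p ∈ K)
    (haut : ∀ σ ∈ Δ, L.IsAut σ)
    (hfix : ∀ σ ∈ Δ, ∀ q, L.Par p q → σ q = q)
    (hpen : ∀ σ ∈ Δ, ∀ M ∈ L.pencil p K, ⇑σ '' M ∈ L.pencil p K)
    (hA1 : ∀ x y : P, ¬ L.Par p x → ¬ L.Par p y → ∃ σ ∈ Δ, σ x = y)
    (hA2 : ∀ r ∈ K, r ≠ p → ∀ x ∈ K, x ≠ p → x ≠ r → ∀ y ∈ K, y ≠ p → y ≠ r →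
      ∃ σ ∈ Δ, σ r = r ∧ σ x = y)    :
    ∀ C ∈ L.pencil p K, ∀ x ∈ C, ∀ y ∈ C, x ≠ p → y ≠ p → x ≠ y →
      line Δ x y = C \ {p} := by
  intro C hC x hx y hy hxp hyp hxy
  have image_eq {σ : Equiv.Perm P} (hσ : σ ∈ Δ) {M : Set P} (hM : M ∈ L.pencil p K)
      (hxM : σ x ∈ M) (hσx : σ x ≠ p) : ⇑σ '' C = M :=
    L.pencil_eq_of_common_point hK hpK (hpen σ hσ C hC) hM (Set.mem_image_of_mem σ hx) hxM hσx
  have fix_p {σ : Equiv.Perm P} (hσ : σ ∈ Δ) : σ p = p := hfix σ hσ p (L.par_equiv.refl p)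
  have map_ne {σ : Equiv.Perm P} (hσ : σ ∈ Δ) {z : P} (hz : z ≠ p) : σ z ≠ p := fun h =>
    hz (σ.injective (h.trans (fix_p hσ).symm))
  have hpx : ¬ L.Par p x := fun h => hxp
    (L.eq_of_par_of_mem (L.mem_circles_of_mem_pencil hK hC) (L.mem_of_mem_pencil hpK hC) hx h)
  ext z
  constructor
  · rintro (rfl | ⟨τ, hτ, hτx, rfl⟩)
    · exact ⟨hx, hxp⟩
    · refine ⟨?_, map_ne hτ hyp⟩
      rw [← image_eq hτ hC (hτx.symm ▸ hx) (hτx.symm ▸ hxp)]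
      exact Set.mem_image_of_mem τ hy
  · rintro ⟨hz, hzp⟩
    by_cases hzx : z = x
    · exact Or.inl hzx
    obtain ⟨q, ⟨hxq, hqK⟩, -⟩ := L.parPoint x K hK
    have hpq : ¬ L.Par p q := fun h => hpx (L.par_equiv.trans h (L.par_equiv.symm hxq))
    obtain ⟨σ, hσ, rfl⟩ := hA1 x q hpx hpq
    have hσC : ⇑σ '' C = K := image_eq hσ (Set.mem_insert K _) hqK (map_ne hσ hxp)
    obtain ⟨τ, hτ, hτx, hτy⟩ := hA2 (σ x) hqK (map_ne hσ hxp)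
      (σ y) (hσC ▸ Set.mem_image_of_mem σ hy) (map_ne hσ hyp) (σ.injective.ne hxy.symm)
      (σ z) (hσC ▸ Set.mem_image_of_mem σ hz) (map_ne hσ hzp) (σ.injective.ne hzx)
    exact Or.inr ⟨σ⁻¹ * τ * σ, mul_mem (mul_mem (inv_mem hσ) hτ) hσ,
      by simp [hτx], by simp [hτy]⟩
end

section
/- Assume (A3). For all distinct x, y ∈ K ∖ {p} there exists φ ∈ Δ with φ(x) = y such that φ maps every circle of the pencil ⟨p,K⟩ onto itself and φ has no fixed point in P ∖ p̄ (i.e., Δ is ⟨p,K⟩-transitive). -/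
open LaguerrePlane

namespace LaguerrePlane

variable {P : Type*} {L : LaguerrePlane P}

lemma eq_of_par {C : Set P} (hC : C ∈ L.Circles) {a b : P} (ha : a ∈ C) (hb : b ∈ C)
    (hab : L.Par a b) : a = b :=
  (L.parPoint a C hC).unique ⟨L.par_equiv.refl a, ha⟩ ⟨hab, hb⟩

lemma circle_eq_of_three {C D : Set P} (hC : C ∈ L.Circles) (hD : D ∈ L.Circles) {a b c : P}
    (haC : a ∈ C) (hbC : b ∈ C) (hcC : c ∈ C) (haD : a ∈ D) (hbD : b ∈ D) (hcD : c ∈ D)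
    (hab : a ≠ b) (hbc : b ≠ c) (hac : a ≠ c) : C = D :=
  (L.joinCircle a b c (fun h => hab (eq_of_par hC haC hbC h))
    (fun h => hbc (eq_of_par hC hbC hcC h)) (fun h => hac (eq_of_par hC haC hcC h))).unique
    ⟨hC, haC, hbC, hcC⟩ ⟨hD, haD, hbD, hcD⟩

/-- The standing assumptions on the group `Δ` acting on the Laguerre plane `L` with the
distinguished pencil of circles touching `K` at `p`. -/
structure PencilGroup (L : LaguerrePlane P) (p : P) (K : Set P)
    (Δ : Subgroup (Equiv.Perm P)) : Prop where
  circle : K ∈ L.Circles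
  mem : p ∈ K
  aut : ∀ σ ∈ Δ, L.IsAut σ
  fix : ∀ σ ∈ Δ, ∀ q, L.Par p q → σ q = q
  pen : ∀ σ ∈ Δ, ∀ M ∈ L.pencil p K, ⇑σ '' M ∈ L.pencil p K
  trans : ∀ x y : P, ¬ L.Par p x → ¬ L.Par p y → ∃ σ ∈ Δ, σ x = y
  stab_trans : ∀ r ∈ K, r ≠ p → ∀ x ∈ K, x ≠ p → x ≠ r → ∀ y ∈ K, y ≠ p → y ≠ r →
      ∃ σ ∈ Δ, σ r = r ∧ σ x = y
  tangent : ∀ M ∈ L.Circles, p ∉ M → ∃! N, N ∈ L.pencil p K ∧ ∃ z, M ∩ N = {z}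

namespace PencilGroup

variable {p : P} {K : Set P} {Δ : Subgroup (Equiv.Perm P)}

section

variable (h : PencilGroup L p K Δ)
include h

lemma pencil_circle {N : Set P} (hN : N ∈ L.pencil p K) : N ∈ L.Circles := by
  rcases hN with rfl | hN
  · exact h.circle
  · exact hN.1

lemma mem_pencil {N : Set P} (hN : N ∈ L.pencil p K) : p ∈ N := by
  rcases hN with rfl | hN
  · exact h.mem
  · have : p ∈ N ∩ K := by rw [hN.2]; rfl
    exact this.1

lemma not_par {N : Set P} (hN : N ∈ L.pencil p K) {x : P} (hx : x ∈ N) (hxp : x ≠ p) :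
    ¬ L.Par p x :=
  fun hp => hxp (eq_of_par (h.pencil_circle hN) (h.mem_pencil hN) hx hp).symm

lemma exists_pencil {x : P} (hx : ¬ L.Par p x) : ∃ N ∈ L.pencil p K, x ∈ N := by
  by_cases hxK : x ∈ K
  · exact ⟨K, Or.inl rfl, hxK⟩
  · obtain ⟨C, ⟨hC, hxC, hKC⟩, -⟩ := L.touching K h.circle p h.mem x hxK hx
    exact ⟨C, Or.inr ⟨hC, by rw [Set.inter_comm]; exact hKC⟩, hxC⟩

lemma pencil_unique {N N' : Set P} (hN : N ∈ L.pencil p K) (hN' : N' ∈ L.pencil p K) {x : P}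
    (hx : ¬ L.Par p x) (hxN : x ∈ N) (hxN' : x ∈ N') : N = N' := by
  have hxp : x ≠ p := by rintro rfl; exact hx (L.par_equiv.refl _)
  rcases hN with rfl | hN <;> rcases hN' with rfl | hN'
  · rfl
  · have : x ∈ N' ∩ N := ⟨hxN', hxN⟩
    rw [hN'.2] at this
    exact absurd this hxp
  · have : x ∈ N ∩ N' := ⟨hxN, hxN'⟩
    rw [hN.2] at this
    exact absurd this hxp
  · have hxK : x ∉ K := fun hxK => by
      have : x ∈ N ∩ K := ⟨hxN, hxK⟩
      rw [hN.2] at this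
      exact hxp this
    exact (L.touching K h.circle p h.mem x hxK hx).unique
      ⟨hN.1, hxN, by rw [Set.inter_comm]; exact hN.2⟩
      ⟨hN'.1, hxN', by rw [Set.inter_comm]; exact hN'.2⟩

lemma not_par_map {σ : Equiv.Perm P} (hσ : σ ∈ Δ) {x : P} (hx : ¬ L.Par p x) :
    ¬ L.Par p (σ x) := by
  intro hp
  apply hx
  rw [(h.aut σ hσ).2, h.fix σ hσ p (L.par_equiv.refl p)]
  exact hp

lemma image_pencil {σ : Equiv.Perm P} (hσ : σ ∈ Δ) {N : Set P} (hN : N ∈ L.pencil p K) {x : P}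
    (hx : ¬ L.Par p x) (hxN : x ∈ N) (hσx : σ x ∈ N) : ⇑σ '' N = N :=
  h.pencil_unique (h.pen σ hσ N hN) hN (h.not_par_map hσ hx) ⟨x, hxN, rfl⟩ hσx

lemma image_tangent {σ : Equiv.Perm P} (hσ : σ ∈ Δ) {N M : Set P} (hN : N ∈ L.pencil p K)
    (hM : M ∈ L.Circles) {z : P} (hz : ¬ L.Par p z) (hMN : M ∩ N = {z}) (hσz : σ z = z) :
    ⇑σ '' M = M := by
  have hzMN : z ∈ M ∩ N := by rw [hMN]; rfl
  obtain ⟨q, ⟨hpq, hqM⟩, -⟩ := L.parPoint p M hM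
  have hqN : q ∉ N := fun hqN => by
    have : q ∈ M ∩ N := ⟨hqM, hqN⟩
    rw [hMN] at this
    rw [Set.mem_singleton_iff.1 this] at hpq
    exact hz hpq
  have hzq : ¬ L.Par z q := fun hzq => hz (L.par_equiv.trans hpq (L.par_equiv.symm hzq))
  have hσN : ⇑σ '' N = N :=
    h.image_pencil hσ hN hz hzMN.2 (by rw [hσz]; exact hzMN.2)
  refine (L.touching N (h.pencil_circle hN) z hzMN.2 q hqN hzq).unique
    ⟨((h.aut σ hσ).1 M).1 hM, ⟨q, hqM, h.fix σ hσ q hpq⟩, ?_⟩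
    ⟨hM, hqM, by rw [Set.inter_comm]; exact hMN⟩
  conv_lhs => rw [← hσN]
  rw [← Set.image_inter σ.injective, Set.inter_comm, hMN, Set.image_singleton, hσz]

/-- The stabilizer of a point fixes pointwise every other generator that it fixes. -/
lemma fix_generator {σ : Equiv.Perm P} (hσ : σ ∈ Δ) {z a : P} (hz : ¬ L.Par p z)
    (hza : ¬ L.Par z a) (hσz : σ z = z) (hσa : L.Par a (σ a)) : σ a = a := by
  obtain ⟨N, hN, hzN⟩ := h.exists_pencil hz
  suffices ∃ M ∈ L.Circles, a ∈ M ∧ ⇑σ '' M = M by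
    obtain ⟨M, hM, haM, hσM⟩ := this
    have : σ a ∈ M := by rw [← hσM]; exact ⟨a, haM, rfl⟩
    exact (eq_of_par hM haM this hσa).symm
  by_cases haN : a ∈ N
  · exact ⟨N, h.pencil_circle hN, haN, h.image_pencil hσ hN hz hzN (by rwa [hσz])⟩
  · obtain ⟨M, ⟨hM, haM, hNM⟩, -⟩ := L.touching N (h.pencil_circle hN) z hzN a haN hza
    exact ⟨M, hM, haM, h.image_tangent hσ hN hM hz (by rw [Set.inter_comm]; exact hNM) hσz⟩

lemma exists_par_ne {x y : P} (hx : x ∈ K) (hy : y ∈ K) (hxp : x ≠ p) (hyp : y ≠ p)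
    (hxy : x ≠ y) : ∃ q, L.Par p q ∧ q ≠ p := by
  obtain ⟨C, hC, -, hCu⟩ := L.nontriv
  obtain ⟨q, hq⟩ := (Set.ne_univ_iff_exists_notMem C).1 hCu
  obtain ⟨r, ⟨hqr, hr⟩, -⟩ := L.parPoint q C hC
  have hne : q ≠ r := by rintro rfl; exact hq hr
  obtain ⟨s, hs⟩ : ∃ s, s ∉ K := by
    by_contra! hs
    exact hne (eq_of_par h.circle (hs q) (hs r) hqr)
  obtain ⟨z, hz, hzp, hzs⟩ : ∃ z ∈ K, z ≠ p ∧ ¬ L.Par z s := by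
    by_cases hxs : L.Par x s
    · exact ⟨y, hy, hyp, fun hys => hxy (eq_of_par h.circle hx hy
        (L.par_equiv.trans hxs (L.par_equiv.symm hys)))⟩
    · exact ⟨x, hx, hxp, hxs⟩
  obtain ⟨M, ⟨hM, -, hKM⟩, -⟩ := L.touching K h.circle z hz s hs hzs
  obtain ⟨t, ⟨hpt, ht⟩, -⟩ := L.parPoint p M hM
  refine ⟨t, hpt, ?_⟩
  rintro rfl
  have : t ∈ K ∩ M := ⟨h.mem, ht⟩
  rw [hKM] at this
  exact hzp (Set.mem_singleton_iff.1 this).symm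

lemma exists_tangent {q : P} (hq : L.Par p q) (hqp : q ≠ p) {N : Set P} (hN : N ∈ L.pencil p K)
    {z : P} (hz : ¬ L.Par p z) (hzN : z ∈ N) : ∃ M ∈ L.Circles, M ∩ N = {z} := by
  obtain ⟨M, ⟨hM, -, hNM⟩, -⟩ := L.touching N (h.pencil_circle hN) z hzN q
    (fun hqN => h.not_par hN hqN hqp hq)
    (fun hzq => hz (L.par_equiv.trans hq (L.par_equiv.symm hzq)))
  exact ⟨M, hM, by rw [Set.inter_comm]; exact hNM⟩

/-- An element of the group fixing a point and another generator is trivial. -/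
lemma eq_one {q : P} (hq : L.Par p q) (hqp : q ≠ p) {σ : Equiv.Perm P} (hσ : σ ∈ Δ) {z a : P}
    (hz : ¬ L.Par p z) (ha : ¬ L.Par p a) (hza : ¬ L.Par z a) (hσz : σ z = z)
    (hσa : L.Par a (σ a)) : σ = 1 := by
  have hσa' := h.fix_generator hσ hz hza hσz hσa
  have hfix : ∀ w, (L.Par p w ∨ L.Par z w ∨ L.Par a w) → σ w = w := by
    rintro w (hw | hw | hw)
    · exact h.fix σ hσ w hw
    · refine h.fix_generator hσ ha (fun haw => hza (L.par_equiv.trans hw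
        (L.par_equiv.symm haw))) hσa' ?_
      have := ((h.aut σ hσ).2 _ _).1 hw
      rw [hσz] at this
      exact L.par_equiv.trans (L.par_equiv.symm hw) this
    · refine h.fix_generator hσ hz (fun hzw => hza (L.par_equiv.trans hzw
        (L.par_equiv.symm hw))) hσz ?_
      have := ((h.aut σ hσ).2 _ _).1 hw
      rw [hσa'] at this
      exact L.par_equiv.trans (L.par_equiv.symm hw) this
  have hcirc : ∀ C ∈ L.Circles, ⇑σ '' C = C := by
    intro C hC
    obtain ⟨u, ⟨hpu, huC⟩, -⟩ := L.parPoint p C hC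
    obtain ⟨v, ⟨hzv, hvC⟩, -⟩ := L.parPoint z C hC
    obtain ⟨w, ⟨haw, hwC⟩, -⟩ := L.parPoint a C hC
    refine (circle_eq_of_three hC (((h.aut σ hσ).1 C).1 hC) huC hvC hwC
      ⟨u, huC, hfix u (.inl hpu)⟩ ⟨v, hvC, hfix v (.inr (.inl hzv))⟩
      ⟨w, hwC, hfix w (.inr (.inr haw))⟩ ?_ ?_ ?_).symm
    · rintro rfl
      exact hz (L.par_equiv.trans hpu (L.par_equiv.symm hzv))
    · rintro rfl
      exact hza (L.par_equiv.trans hzv (L.par_equiv.symm haw))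
    · rintro rfl
      exact ha (L.par_equiv.trans hpu (L.par_equiv.symm haw))
  ext w
  by_cases hw : L.Par p w
  · exact h.fix σ hσ w hw
  obtain ⟨N, hN, hwN⟩ := h.exists_pencil hw
  obtain ⟨M, hM, hMN⟩ := h.exists_tangent hq hqp hN hw hwN
  have hwMN : w ∈ M ∩ N := by rw [hMN]; rfl
  have hσw : σ w ∈ M ∩ N := by
    rw [← hcirc M hM, ← hcirc N (h.pencil_circle hN)]
    exact ⟨⟨w, hwMN.1, rfl⟩, ⟨w, hwN, rfl⟩⟩
  rw [hMN] at hσw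
  exact hσw

lemma exists_map_pair {a b x w : P} (ha : a ∈ K) (hb : b ∈ K) (hx : x ∈ K) (hw : w ∈ K)
    (hap : a ≠ p) (hbp : b ≠ p) (hxp : x ≠ p) (hwp : w ≠ p) (hab : a ≠ b) (hxw : x ≠ w) :
    ∃ σ ∈ Δ, σ a = x ∧ σ b = w := by
  have hKp : K ∈ L.pencil p K := Or.inl rfl
  obtain ⟨τ, hτ, rfl⟩ := h.trans a x (h.not_par hKp ha hap) (h.not_par hKp hx hxp)
  have hτK := h.image_pencil hτ hKp (h.not_par hKp ha hap) ha hx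
  have hτp := h.fix τ hτ p (L.par_equiv.refl p)
  obtain ⟨ρ, hρ, hρ1, hρ2⟩ := h.stab_trans (τ a) hx hxp (τ b)
    (by rw [← hτK]; exact ⟨b, hb, rfl⟩) (fun hb' => hbp (τ.injective (hb'.trans hτp.symm)))
    (fun hb' => hab (τ.injective hb').symm) w hw hwp hxw.symm
  exact ⟨ρ * τ, Δ.mul_mem hρ hτ, hρ1, hρ2⟩

/-- The points of a circle touching `K` at `z` that lie on a common circle of the pencil are
swapped by an involution fixing `z`. -/
lemma exists_involution {q : P} (hq : L.Par p q) (hqp : q ≠ p) {z y : P} (hzK : z ∈ K)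
    (hzp : z ≠ p) (hy : ¬ L.Par p y) (hzy : ¬ L.Par z y) {N : Set P} (hN : N ∈ L.pencil p K)
    (hyN : y ∈ N) (hyK : y ∉ K) :
    ∃ g ∈ Δ, g z = z ∧ g y ≠ y ∧ g * g = 1 ∧ ⇑g '' N = N := by
  have hKp : K ∈ L.pencil p K := Or.inl rfl
  have hz := h.not_par hKp hzK hzp
  obtain ⟨M, ⟨hM, hyM, hKM⟩, -⟩ := L.touching K h.circle z hzK y hyK hzy
  have hMK : M ∩ K = {z} := by rw [Set.inter_comm]; exact hKM
  have hzM : z ∈ M ∩ K := by rw [hMK]; rfl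
  have hpM : p ∉ M := fun hpM => by
    have : p ∈ M ∩ K := ⟨hpM, h.mem⟩
    rw [hMK] at this
    exact hzp (Set.mem_singleton_iff.1 this).symm
  obtain ⟨y', hy'M, hy'N, hyy'⟩ : ∃ y', y' ∈ M ∧ y' ∈ N ∧ y' ≠ y := by
    by_contra! hcon
    have : N = K := (h.tangent M hM hpM).unique
      ⟨hN, y, Set.eq_singleton_iff_unique_mem.2 ⟨⟨hyM, hyN⟩, fun t ht => hcon t ht.1 ht.2⟩⟩
      ⟨hKp, z, hMK⟩
    exact hyK (this ▸ hyN)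
  have hy' : ¬ L.Par p y' := h.not_par hN hy'N (by rintro rfl; exact hpM hy'M)
  have hzy' : ¬ L.Par z y' := fun hzy' => by
    have := eq_of_par hM hzM.1 hy'M hzy'
    subst this
    exact hyK (h.pencil_unique hN hKp hy' hy'N hzK ▸ hyN)
  obtain ⟨a, ⟨hya, haK⟩, -⟩ := L.parPoint y K h.circle
  obtain ⟨b, ⟨hyb, hbK⟩, -⟩ := L.parPoint y' K h.circle
  obtain ⟨g, hg, hgz, hga⟩ := h.stab_trans z hzK hzp a haK
    (by rintro rfl; exact hy (L.par_equiv.symm hya))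
    (by rintro rfl; exact hzy (L.par_equiv.symm hya)) b hbK
    (by rintro rfl; exact hy' (L.par_equiv.symm hyb))
    (by rintro rfl; exact hzy' (L.par_equiv.symm hyb))
  have hgM := h.image_tangent hg hKp hM hz hMK hgz
  have hgy : g y = y' := by
    refine eq_of_par hM (by rw [← hgM]; exact ⟨y, hyM, rfl⟩) hy'M ?_
    have := ((h.aut g hg).2 _ _).1 hya
    rw [hga] at this
    exact L.par_equiv.trans this (L.par_equiv.symm hyb)
  have hgN : ⇑g '' N = N := h.image_pencil hg hN hy hyN (by rwa [hgy])
  have hgy' : g y' = y := by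
    by_contra hne
    have hMN : M = N := circle_eq_of_three hM (h.pencil_circle hN) (a := g y') (b := y) (c := y')
      (by rw [← hgM]; exact ⟨y', hy'M, rfl⟩) hyM hy'M
      (by rw [← hgN]; exact ⟨y', hy'N, rfl⟩) hyN hy'N hne hyy'.symm
      (fun he => hyy' (g.injective (he.trans hgy.symm)))
    exact hpM (hMN ▸ h.mem_pencil hN)
  refine ⟨g, hg, hgz, by rwa [hgy], ?_, hgN⟩
  refine h.eq_one hq hqp (Δ.mul_mem hg hg) hz hy hzy ?_ ?_
  · simp [hgz]
  · simp only [Equiv.Perm.mul_apply, hgy, hgy']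
    exact L.par_equiv.refl y

lemma eq_one_of_fix_two {q : P} (hq : L.Par p q) (hqp : q ≠ p) {σ : Equiv.Perm P} (hσ : σ ∈ Δ)
    {z a : P} (hz : z ∈ K) (ha : a ∈ K) (hzp : z ≠ p) (hap : a ≠ p) (hza : z ≠ a)
    (hσz : σ z = z) (hσa : σ a = a) : σ = 1 :=
  h.eq_one hq hqp hσ (h.not_par (Or.inl rfl) hz hzp) (h.not_par (Or.inl rfl) ha hap)
    (fun hp => hza (eq_of_par h.circle hz ha hp)) hσz (by rw [hσa]; exact L.par_equiv.refl a)

lemma eq_of_eq_two {q : P} (hq : L.Par p q) (hqp : q ≠ p) {σ τ : Equiv.Perm P} (hσ : σ ∈ Δ)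
    (hτ : τ ∈ Δ) {z a : P} (hz : z ∈ K) (ha : a ∈ K) (hzp : z ≠ p) (hap : a ≠ p) (hza : z ≠ a)
    (hσz : σ z = τ z) (hσa : σ a = τ a) : σ = τ := by
  have : τ⁻¹ * σ = 1 := h.eq_one_of_fix_two hq hqp (Δ.mul_mem (Δ.inv_mem hτ) hσ) hz ha hzp hap
    hza (by simp [hσz]) (by simp [hσa])
  exact (inv_mul_eq_one.1 this).symm

lemma mem_of_fix {σ : Equiv.Perm P} (hσ : σ ∈ Δ) {z a : P} (hz : z ∈ K) (hσz : σ z ∈ K)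
    (hzp : z ≠ p) (ha : a ∈ K) (hap : a ≠ p) : σ a ∈ K ∧ σ a ≠ p := by
  constructor
  · rw [← h.image_pencil hσ (Or.inl rfl) (h.not_par (Or.inl rfl) hz hzp) hz hσz]
    exact ⟨a, ha, rfl⟩
  · intro he
    exact hap (σ.injective (he.trans (h.fix σ hσ p (L.par_equiv.refl p)).symm))

/-- The stabilizer of a point of `K` contains at most one involution. -/
lemma involution_unique {q : P} (hq : L.Par p q) (hqp : q ≠ p) {i j : Equiv.Perm P} (hi : i ∈ Δ)
    (hj : j ∈ Δ) (hii : i * i = 1) (hjj : j * j = 1) (hi1 : i ≠ 1) (hj1 : j ≠ 1) {m z : P}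
    (hm : m ∈ K) (hmp : m ≠ p) (hz : z ∈ K) (hzp : z ≠ p) (hmz : m ≠ z) (him : i m = m)
    (hjm : j m = m) : i = j := by
  have hii' : ∀ w, i (i w) = w := fun w => by
    rw [← Equiv.Perm.mul_apply, hii, Equiv.Perm.one_apply]
  have hjj' : ∀ w, j (j w) = w := fun w => by
    rw [← Equiv.Perm.mul_apply, hjj, Equiv.Perm.one_apply]
  have hiz : i z ≠ z := fun he =>
    hi1 (h.eq_one_of_fix_two hq hqp hi hm hz hmp hzp hmz him he)
  have hjz : j z ≠ z := fun he =>
    hj1 (h.eq_one_of_fix_two hq hqp hj hm hz hmp hzp hmz hjm he)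
  obtain ⟨hizK, hizp⟩ := h.mem_of_fix hi hm (by rwa [him]) hmp hz hzp
  obtain ⟨hjzK, hjzp⟩ := h.mem_of_fix hj hm (by rwa [hjm]) hmp hz hzp
  obtain ⟨k, hk, hkz, hkx⟩ := h.stab_trans z hz hzp (i z) hizK hizp hiz (j z) hjzK hjzp hjz
  have hconj : k * i = j * k := by
    refine h.eq_of_eq_two hq hqp (Δ.mul_mem hk hi) (Δ.mul_mem hj hk) hz hizK hzp hizp hiz.symm
      ?_ ?_
    · simp [hkz, hkx]
    · simp [hkz, hkx, hii', hjj']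
  have hjk : j (k m) = k m := by
    have := congrArg (fun f : Equiv.Perm P => f m) hconj
    simpa [him] using this.symm
  obtain ⟨hkmK, hkmp⟩ := h.mem_of_fix hk hz (by rwa [hkz]) hzp hm hmp
  have hkm : k m = m := by
    by_contra hne
    exact hj1 (h.eq_one_of_fix_two hq hqp hj hkmK hm hkmp hmp hne hjk hjm)
  have hk1 := h.eq_one_of_fix_two hq hqp hk hm hz hmp hzp hmz hkm hkz
  simpa [hk1] using hconj

lemma not_mem_of_ne {N : Set P} (hN : N ∈ L.pencil p K) (hNK : N ≠ K) {y : P} (hyN : y ∈ N)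
    (hy : ¬ L.Par p y) : y ∉ K :=
  fun hyK => hNK (h.pencil_unique hN (Or.inl rfl) hy hyN hyK)

/-- An involution fixing a point of `K` leaves every circle of the pencil invariant. -/
lemma involution_image {q : P} (hq : L.Par p q) (hqp : q ≠ p) {i : Equiv.Perm P} (hi : i ∈ Δ)
    (hii : i * i = 1) (hi1 : i ≠ 1) {m z : P} (hm : m ∈ K) (hmp : m ≠ p) (hz : z ∈ K)
    (hzp : z ≠ p) (hmz : m ≠ z) (him : i m = m) {N : Set P} (hN : N ∈ L.pencil p K) :
    ⇑i '' N = N := by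
  have hKp : K ∈ L.pencil p K := Or.inl rfl
  by_cases hNK : N = K
  · subst hNK
    exact h.image_pencil hi hN (h.not_par hN hm hmp) hm (by rwa [him])
  obtain ⟨y, ⟨hzy, hyN⟩, -⟩ := L.parPoint z N (h.pencil_circle hN)
  have hy : ¬ L.Par p y := fun hp =>
    h.not_par hKp hz hzp (L.par_equiv.trans hp (L.par_equiv.symm hzy))
  have hmy : ¬ L.Par m y := fun hp =>
    hmz (eq_of_par h.circle hm hz (L.par_equiv.trans hp (L.par_equiv.symm hzy)))
  obtain ⟨g, hg, hgm, hgy, hgg, hgN⟩ := h.exists_involution hq hqp hm hmp hy hmy hN hyN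
    (h.not_mem_of_ne hN hNK hyN hy)
  have hg1 : g ≠ 1 := by rintro rfl; exact hgy rfl
  rwa [h.involution_unique hq hqp hi hg hii hgg hi1 hg1 hm hmp hz hzp hmz him hgm]

lemma exists_involution_fix {q : P} (hq : L.Par p q) (hqp : q ≠ p) {m z : P} (hm : m ∈ K)
    (hmp : m ≠ p) (hz : z ∈ K) (hzp : z ≠ p) (hmz : m ≠ z) :
    ∃ i ∈ Δ, i * i = 1 ∧ i ≠ 1 ∧ i m = m := by
  have hKp : K ∈ L.pencil p K := Or.inl rfl
  obtain ⟨M, hM, hMK⟩ := h.exists_tangent hq hqp hKp (h.not_par hKp hm hmp) hm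
  obtain ⟨y, ⟨hzy, hyM⟩, -⟩ := L.parPoint z M hM
  have hmy : ¬ L.Par m y := fun hp =>
    hmz (eq_of_par h.circle hm hz (L.par_equiv.trans hp (L.par_equiv.symm hzy)))
  have hy : ¬ L.Par p y := fun hp =>
    h.not_par hKp hz hzp (L.par_equiv.trans hp (L.par_equiv.symm hzy))
  have hyK : y ∉ K := fun hyK => by
    have : y ∈ M ∩ K := ⟨hyM, hyK⟩
    rw [hMK] at this
    rw [Set.mem_singleton_iff.1 this] at hmy
    exact hmy (L.par_equiv.refl m)
  obtain ⟨N, hN, hyN⟩ := h.exists_pencil hy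
  obtain ⟨g, hg, hgm, hgy, hgg, -⟩ := h.exists_involution hq hqp hm hmp hy hmy hN hyN hyK
  exact ⟨g, hg, hgg, by rintro rfl; exact hgy rfl, hgm⟩

lemma exists_involution_swap {q : P} (hq : L.Par p q) (hqp : q ≠ p) {x y : P} (hx : x ∈ K)
    (hxp : x ≠ p) (hy : y ∈ K) (hyp : y ≠ p) (hxy : x ≠ y) :
    ∃ i ∈ Δ, i * i = 1 ∧ i x = y ∧ ∃ m ∈ K, m ≠ p ∧ i m = m := by
  obtain ⟨g, hg, hgg, hg1, hgx⟩ := h.exists_involution_fix hq hqp hx hxp hy hyp hxy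
  have hgy : y ≠ g y := fun he =>
    hg1 (h.eq_one_of_fix_two hq hqp hg hx hy hxp hyp hxy hgx he.symm)
  obtain ⟨hgyK, hgyp⟩ := h.mem_of_fix hg hx (by rwa [hgx]) hxp hy hyp
  obtain ⟨σ, hσ, hσ1, hσ2⟩ := h.exists_map_pair hy hgyK hx hy hyp hgyp hxp hyp hgy hxy
  obtain ⟨hmK, hmp⟩ := h.mem_of_fix hσ hy (by rwa [hσ1]) hyp hx hxp
  refine ⟨σ * g * σ⁻¹, Δ.mul_mem (Δ.mul_mem hσ hg) (Δ.inv_mem hσ), ?_, ?_, σ x, hmK, hmp, ?_⟩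
  · have : σ * g * σ⁻¹ * (σ * g * σ⁻¹) = σ * (g * g) * σ⁻¹ := by group
    rw [this, hgg]
    group
  · rw [← hσ2]
    nth_rewrite 1 [← hσ1]
    simp
  · simp [hgx]

/-- The group acts transitively on `K` without `p` by fixed-point-free elements that leave
every circle of the pencil invariant. -/
lemma exists_translation {x y : P} (hx : x ∈ K) (hy : y ∈ K) (hxp : x ≠ p) (hyp : y ≠ p)
    (hxy : x ≠ y) :
    ∃ φ ∈ Δ, φ x = y ∧ (∀ M ∈ L.pencil p K, ⇑φ '' M = M) ∧
      ∀ z : P, ¬ L.Par p z → φ z ≠ z := by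
  obtain ⟨q, hq, hqp⟩ := h.exists_par_ne hx hy hxp hyp hxy
  obtain ⟨g, hg, hgg, hg1, hgx⟩ := h.exists_involution_fix hq hqp hx hxp hy hyp hxy
  obtain ⟨i, hi, hii, hix, m, hm, hmp, him⟩ :=
    h.exists_involution_swap hq hqp hx hxp hy hyp hxy
  have hi1 : i ≠ 1 := by rintro rfl; exact hxy hix
  have hmx : m ≠ x := by rintro rfl; exact hxy (him.symm.trans hix)
  have hgg' : ∀ w, g (g w) = w := fun w => by
    rw [← Equiv.Perm.mul_apply, hgg, Equiv.Perm.one_apply]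
  have hii' : ∀ w, i (i w) = w := fun w => by
    rw [← Equiv.Perm.mul_apply, hii, Equiv.Perm.one_apply]
  have himg : ∀ M ∈ L.pencil p K, ⇑(i * g) '' M = M := fun M hM => by
    rw [Equiv.Perm.coe_mul, Set.image_comp,
      h.involution_image hq hqp hg hgg hg1 hx hxp hy hyp hxy hgx hM,
      h.involution_image hq hqp hi hii hi1 hm hmp hx hxp hmx him hM]
  have hφ := Δ.mul_mem hi hg
  refine ⟨i * g, hφ, by simp [hgx, hix], himg, fun z hz hfz => ?_⟩
  obtain ⟨w, ⟨hzw, hw⟩, -⟩ := L.parPoint z K h.circle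
  have hwp : w ≠ p := by rintro rfl; exact hz (L.par_equiv.symm hzw)
  have hfw : i (g w) = w := by
    refine (eq_of_par h.circle hw ?_ ?_).symm
    · have : (i * g) w ∈ ⇑(i * g) '' K := ⟨w, hw, rfl⟩
      rwa [himg K (Or.inl rfl)] at this
    · have := ((h.aut _ hφ).2 _ _).1 hzw
      rw [hfz] at this
      exact L.par_equiv.trans (L.par_equiv.symm hzw) this
  have hgi : g w = i w := by rw [← hii' (g w), hfw]
  have hgwK := h.mem_of_fix hg hx (by rwa [hgx]) hxp hw hwp
  by_cases hgw : w = g w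
  · by_cases hxw : x = w
    · subst hxw
      exact hxy (by rw [← hix, ← hgi, hgx])
    · exact hg1 (h.eq_one_of_fix_two hq hqp hg hx hw hxp hwp hxw hgx hgw.symm)
  · have : g = i := h.eq_of_eq_two hq hqp hg hi hw hgwK.1 hwp hgwK.2 hgw hgi
      (by rw [hgg', hfw])
    subst this
    exact hxy (hgx.symm.trans hix)

end

end PencilGroup

end LaguerrePlane

/-- assume (A3).  For all distinct x, y ∈ K ∖ {p} there is φ ∈ Δ
with φ(x) = y mapping every circle of ⟨p,K⟩ onto itself and having no fixed
point in P ∖ p̄ (Δ is ⟨p,K⟩-transitive). -/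
theorem pencil_transitive
    {P : Type*} (L : LaguerrePlane P) (p : P) (K : Set P)
    (Δ : Subgroup (Equiv.Perm P))
    (hK : K ∈ L.Circles) (hpK : p ∈ K)
    (haut : ∀ σ ∈ Δ, L.IsAut σ)
    (hfix : ∀ σ ∈ Δ, ∀ q, L.Par p q → σ q = q)
    (hpen : ∀ σ ∈ Δ, ∀ M ∈ L.pencil p K, ⇑σ '' M ∈ L.pencil p K)
    (hA1 : ∀ x y : P, ¬ L.Par p x → ¬ L.Par p y → ∃ σ ∈ Δ, σ x = y)
    (hA2 : ∀ r ∈ K, r ≠ p → ∀ x ∈ K, x ≠ p → x ≠ r → ∀ y ∈ K, y ≠ p → y ≠ r →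
      ∃ σ ∈ Δ, σ r = r ∧ σ x = y)    (hA3 : ∀ M ∈ L.Circles, p ∉ M → ∃! N, N ∈ L.pencil p K ∧ ∃ z, M ∩ N = {z})    :
    ∀ x ∈ K, ∀ y ∈ K, x ≠ p → y ≠ p → x ≠ y →
    ∃ φ ∈ Δ, φ x = y ∧ (∀ M ∈ L.pencil p K, ⇑φ '' M = M) ∧
      ∀ z : P, ¬ L.Par p z → φ z ≠ z := by
  intro x hx y hy hxp hyp hxy
  exact PencilGroup.exists_translation
    ⟨hK, hpK, haut, hfix, hpen, hA1, hA2, hA3⟩ hx hy hxp hyp hxy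
end
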